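/- Let λ > 0, μ > 0, ν > 0 and let u : ℝ → [0,∞] be measurable. Then for every x ∈ ℝ the left tempered fractional integrals satisfy the semigroup property (TI^{μ,λ}(TI^{ν,λ}u))(x) = (TI^{μ+ν,λ}u)(x), as an identity in [0,∞]. -/

import Mathlib

open MeasureTheory

/-- The left tempered fractional integral of order μ with tempering parameter λ
of a nonnegative measurable function u : ℝ → [0,∞], as a Lebesgue integral:
(TI^{μ,λ}u)(x) = (1/Γ(μ)) ∫_{−∞}^x e^{−λ(x−y)} (x−y)^{μ−1} u(y) dy. -/
noncomputable def temperedIntL (lam mu : ℝ) (u : ℝ → ENNReal) (x : ℝ) : ENNReal :=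
  ENNReal.ofReal (1 / Real.Gamma mu) *
    ∫⁻ y in Set.Iio x, ENNReal.ofReal (Real.exp (-(lam * (x - y))) * (x - y) ^ (mu - 1)) * u y

open scoped ENNReal

/-- The tempered fractional kernel `t ↦ e^{-λt} t^{μ-1} / Γ(μ)` on `(0, ∞)`, extended by zero. -/
noncomputable def temperedKernel (lam mu : ℝ) : ℝ → ℝ≥0∞ :=
  (Set.Ioi 0).indicator fun t ↦
    ENNReal.ofReal (1 / Real.Gamma mu * (Real.exp (-(lam * t)) * t ^ (mu - 1)))

lemma measurable_temperedKernel (lam mu : ℝ) : Measurable (temperedKernel lam mu) :=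
  Measurable.indicator (by fun_prop) measurableSet_Ioi

lemma temperedKernel_of_pos {lam mu t : ℝ} (ht : 0 < t) : temperedKernel lam mu t =
    ENNReal.ofReal (1 / Real.Gamma mu * (Real.exp (-(lam * t)) * t ^ (mu - 1))) :=
  Set.indicator_of_mem (Set.mem_Ioi.2 ht) _

lemma temperedKernel_of_nonpos {lam mu t : ℝ} (ht : t ≤ 0) : temperedKernel lam mu t = 0 :=
  Set.indicator_of_notMem (Set.notMem_Ioi.2 ht) _

lemma temperedIntL_eq_lconvolution {lam mu : ℝ} (hmu : 0 < mu) {u : ℝ → ℝ≥0∞}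
    (hu : Measurable u) : temperedIntL lam mu u = u ⋆ₗ temperedKernel lam mu := by
  ext x
  rw [temperedIntL, lconvolution_def, ← lintegral_const_mul _ (by fun_prop),
    ← lintegral_indicator measurableSet_Iio]
  refine lintegral_congr fun y ↦ ?_
  rw [neg_add_eq_sub]
  by_cases hy : y < x
  · rw [Set.indicator_of_mem (Set.mem_Iio.2 hy), temperedKernel_of_pos (sub_pos.2 hy),
      ENNReal.ofReal_mul (one_div_pos.2 (Real.Gamma_pos_of_pos hmu)).le]
    ring
  · rw [Set.indicator_of_notMem (Set.notMem_Iio.2 (not_lt.1 hy)),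
      temperedKernel_of_nonpos (sub_nonpos.2 (not_lt.1 hy)), mul_zero]

/-- Rescaled to the unit interval, the product of two tempered kernels is a multiple of the
density of a beta distribution. -/
lemma temperedKernel_mul_temperedKernel {lam mu nu x : ℝ} (hmu : 0 < mu) (hnu : 0 < nu)
    (hx : 0 < x) (s : ℝ) :
    ENNReal.ofReal x * (temperedKernel lam mu (x * s) * temperedKernel lam nu (-(x * s) + x)) =
      temperedKernel lam (mu + nu) x * ProbabilityTheory.betaPDF mu nu s := by
  rcases le_or_gt s 0 with hs | hs
  · rw [ProbabilityTheory.betaPDF_eq_zero_of_nonpos hs,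
      temperedKernel_of_nonpos (mul_nonpos_of_nonneg_of_nonpos hx.le hs)]
    simp
  rcases le_or_gt 1 s with hs' | hs'
  · rw [ProbabilityTheory.betaPDF_eq_zero_of_one_le hs',
      temperedKernel_of_nonpos (t := -(x * s) + x) (by nlinarith)]
    simp
  have h1 : 0 < 1 - s := sub_pos.2 hs'
  have hxs : -(x * s) + x = x * (1 - s) := by ring
  have hΓμ := Real.Gamma_pos_of_pos hmu
  have hΓν := Real.Gamma_pos_of_pos hnu
  have hΓ := Real.Gamma_pos_of_pos (add_pos hmu hnu)
  rw [hxs, temperedKernel_of_pos (mul_pos hx hs), temperedKernel_of_pos (mul_pos hx h1),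
    temperedKernel_of_pos hx, ProbabilityTheory.betaPDF_of_pos_lt_one hs hs',
    ← ENNReal.ofReal_mul (by positivity), ← ENNReal.ofReal_mul (by positivity),
    ← ENNReal.ofReal_mul (by positivity), Real.mul_rpow hx.le hs.le, Real.mul_rpow hx.le h1.le]
  have hexp : Real.exp (-(lam * x)) =
      Real.exp (-(lam * (x * s))) * Real.exp (-(lam * (x * (1 - s)))) := by
    rw [← Real.exp_add]
    ring_nf
  have hpow : x ^ (mu + nu - 1) = x * x ^ (mu - 1) * x ^ (nu - 1) := by
    rw [← Real.rpow_one_add' hx.le (by linarith), ← Real.rpow_add hx]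
    ring_nf
  rw [hexp, hpow, ProbabilityTheory.beta]
  congr 1
  field_simp

lemma lintegral_eq_ofReal_mul_lintegral_comp_mul_left {a : ℝ} (ha : 0 < a) {f : ℝ → ℝ≥0∞}
    (hf : Measurable f) : ∫⁻ y, f y = ENNReal.ofReal a * ∫⁻ s, f (a * s) := by
  conv_lhs => rw [← Real.smul_map_volume_mul_left ha.ne', abs_of_pos ha]
  rw [lintegral_smul_measure, lintegral_map hf (by fun_prop), smul_eq_mul]

lemma temperedKernel_lconvolution_temperedKernel (lam : ℝ) {mu nu : ℝ} (hmu : 0 < mu)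
    (hnu : 0 < nu) :
    temperedKernel lam mu ⋆ₗ temperedKernel lam nu = temperedKernel lam (mu + nu) := by
  have hMμ := measurable_temperedKernel lam mu
  have hMν := measurable_temperedKernel lam nu
  ext x
  rw [lconvolution_def]
  rcases le_or_gt x 0 with hx | hx
  · rw [temperedKernel_of_nonpos hx, ← lintegral_zero (μ := (volume : Measure ℝ))]
    refine lintegral_congr fun y ↦ ?_
    rcases le_or_gt y 0 with hy | hy
    · rw [temperedKernel_of_nonpos hy, zero_mul]
    · rw [temperedKernel_of_nonpos (t := -y + x) (by linarith), mul_zero]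
  · rw [lintegral_eq_ofReal_mul_lintegral_comp_mul_left hx (by fun_prop),
      ← lintegral_const_mul _ (by fun_prop)]
    simp_rw [temperedKernel_mul_temperedKernel hmu hnu hx]
    have hβ : Measurable (ProbabilityTheory.betaPDF mu nu) :=
      (ProbabilityTheory.measurable_betaPDFReal mu nu).ennreal_ofReal
    rw [lintegral_const_mul _ hβ,
      ProbabilityTheory.lintegral_betaPDF_eq_one hmu hnu, mul_one]

/-- semigroup property of the left tempered fractional integrals:
for λ > 0, μ > 0, ν > 0 and measurable u : ℝ → [0,∞],
TI^{μ,λ}(TI^{ν,λ}u) = TI^{μ+ν,λ}u pointwise (in [0,∞]). -/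
theorem temperedIntL_semigroup (lam mu nu : ℝ) (hlam : 0 < lam) (hmu : 0 < mu) (hnu : 0 < nu)
    (u : ℝ → ENNReal) (hu : Measurable u) (x : ℝ) :
    temperedIntL lam mu (temperedIntL lam nu u) x = temperedIntL lam (mu + nu) u x := by
  have hMμ := measurable_temperedKernel lam mu
  have hMν := measurable_temperedKernel lam nu
  rw [temperedIntL_eq_lconvolution hnu hu,
    temperedIntL_eq_lconvolution hmu (measurable_lconvolution _ hu hMν),
    temperedIntL_eq_lconvolution (add_pos hmu hnu) hu, ← lconvolution_assoc hu hMν hMμ,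
    temperedKernel_lconvolution_temperedKernel lam hnu hmu, add_comm nu mu]
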